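/- arXiv:1701.08826 — 2 statements merged into one kernel-verified Lean document; each statement's English description precedes it below -/
import Mathlib

section
/- Let (A₁,…,A_k) and (B₁,…,B_k) be two k-tuples of m×n complex matrices. There exist unitary matrices U (m×m) and V (n×n) such that UA_iV = B_i for every i = 1,…,k if and only if trace w(A₁ᴴA₁, …, A_iᴴA_j, …, A_kᴴA_k) = trace w(B₁ᴴB₁, …, B_iᴴB_j, …, B_kᴴB_k) for every word w(x₁₁,…,x_{ij},…,x_{kk}) in k² noncommuting variables; that is, for every nonempty finite sequence of index pairs (i₁,j₁),…,(i_ℓ,j_ℓ) with entries in {1,…,k}, trace((A_{i₁}ᴴA_{j₁})···(A_{i_ℓ}ᴴA_{j_ℓ})) = trace((B_{i₁}ᴴB_{j₁})···(B_{i_ℓ}ᴴB_{j_ℓ})). -/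
open Matrix

section SemisimpleModule

open Module LinearMap

variable {K R M N : Type*} [Field K] [Ring R] [Algebra K R]
  [AddCommGroup M] [Module K M] [Module R M] [IsScalarTower K R M]
  [AddCommGroup N] [Module K N] [Module R N] [IsScalarTower K R N]

theorem Module.trace_lsmul_congr (e : M ≃ₗ[R] N) (r : R) :
    trace K M (Algebra.lsmul K K M r) = trace K N (Algebra.lsmul K K N r) := by
  rw [← trace_conj' _ (e.restrictScalars K)]
  congr 1
  ext x
  simp [LinearEquiv.conj_apply]

theorem Module.trace_lsmul_prod [FiniteDimensional K M] [FiniteDimensional K N] (r : R) :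
    trace K (M × N) (Algebra.lsmul K K (M × N) r) =
      trace K M (Algebra.lsmul K K M r) + trace K N (Algebra.lsmul K K N r) := by
  rw [← trace_prodMap']
  rfl

theorem Module.finrank_eq_of_trace_eq [CharZero K]
    [FiniteDimensional K M] [FiniteDimensional K N]
    (h : ∀ r : R, trace K M (Algebra.lsmul K K M r) = trace K N (Algebra.lsmul K K N r)) :
    finrank K M = finrank K N := by
  simpa using h 1

/-- If two finite-dimensional modules have the same traces, are semisimple and the first one
is nonzero, then there is a nonzero homomorphism between them: otherwise, by the density theorem,
some scalar acts as the projection onto the first module. -/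
theorem Module.exists_linearMap_ne_zero_of_trace_eq [CharZero K]
    [FiniteDimensional K M] [FiniteDimensional K N] [Nontrivial M]
    [IsSemisimpleModule R M] [IsSemisimpleModule R N]
    (h : ∀ r : R, trace K M (Algebra.lsmul K K M r) = trace K N (Algebra.lsmul K K N r)) :
    (∃ f : M →ₗ[R] N, f ≠ 0) ∨ ∃ g : N →ₗ[R] M, g ≠ 0 := by
  by_contra! H
  obtain ⟨hMN, hNM⟩ := H
  let p : End (End R (M × N)) (M × N) :=
    { toFun := fun x => (x.1, 0)
      map_add' := fun x y => by simp
      map_smul' := fun φ x => by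
        have h₁ : (φ (x.1, 0)).2 = 0 :=
          LinearMap.congr_fun (hMN (snd R M N ∘ₗ φ ∘ₗ inl R M N)) x.1
        have h₂ : (φ (0, x.2)).1 = 0 :=
          LinearMap.congr_fun (hNM (fst R M N ∘ₗ φ ∘ₗ inr R M N)) x.2
        have h₃ : φ x = φ (x.1, 0) + φ (0, x.2) := by rw [← map_add]; simp
        simp only [End.smul_def, RingHom.id_apply]
        ext
        · simp [h₃, h₂]
        · simp [h₁] }
  have : IsSemisimpleModule R (M × N) :=
    have := IsSemisimpleModule.range (inl R M N)
    have := IsSemisimpleModule.range (inr R M N)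
    have := IsSemisimpleModule.sup (p := range (inl R M N)) (q := range (inr R M N)) ‹_› ‹_›
    .congr (Submodule.topEquiv.symm ≪≫ₗ LinearEquiv.ofEq _ _ sup_range_inl_inr.symm)
  classical
  let b := finBasis K (M × N)
  obtain ⟨r, hr⟩ := jacobson_density p (Finset.univ.image b)
  have hr' : Algebra.lsmul K K (M × N) r = (inl K M N ∘ₗ fst K M N) :=
    b.ext fun i => (hr (b i) (by simp)).symm
  have hM : Algebra.lsmul K K M r = LinearMap.id := by
    ext x
    simpa using congr(($hr' (x, 0)).1)
  have hN : Algebra.lsmul K K N r = 0 := by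
    ext x
    simpa using congr(($hr' (0, x)).2)
  have := h r
  rw [hM, hN, trace_id, map_zero, Nat.cast_eq_zero] at this
  exact finrank_pos.ne' this

/-- Splitting off the range of a nonzero homomorphism reduces the construction of an isomorphism
to submodules of smaller dimension. -/
theorem Module.nonempty_linearEquiv_of_linearMap_ne_zero
    [FiniteDimensional K M] [FiniteDimensional K N]
    [IsSemisimpleModule R M] [IsSemisimpleModule R N]
    (h : ∀ r : R, trace K M (Algebra.lsmul K K M r) = trace K N (Algebra.lsmul K K N r))
    (f : M →ₗ[R] N) (hf : f ≠ 0)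
    (ih : ∀ (p : Submodule R M) (q : Submodule R N), finrank K p < finrank K M →
      (∀ r : R, trace K p (Algebra.lsmul K K p r) = trace K q (Algebra.lsmul K K q r)) →
      Nonempty (p ≃ₗ[R] q)) :
    Nonempty (M ≃ₗ[R] N) := by
  obtain ⟨p, hp⟩ := exists_isCompl (ker f)
  obtain ⟨q, hq⟩ := exists_isCompl (range f)
  have fin (P : Submodule R M) : FiniteDimensional K P :=
    inferInstanceAs (FiniteDimensional K (P.restrictScalars K))
  have fin' (P : Submodule R N) : FiniteDimensional K P :=
    inferInstanceAs (FiniteDimensional K (P.restrictScalars K))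
  let eM : (ker f × range f) ≃ₗ[R] M :=
    (LinearEquiv.prodCongr (.refl R _)
      (f.quotKerEquivRange.symm ≪≫ₗ Submodule.quotientEquivOfIsCompl _ _ hp)) ≪≫ₗ
      Submodule.prodEquivOfIsCompl _ _ hp
  let eN : (q × range f) ≃ₗ[R] N := Submodule.prodEquivOfIsCompl _ _ hq.symm
  have hlt : finrank K (ker f) < finrank K M := by
    refine Submodule.finrank_lt (s := (ker f).restrictScalars K) fun htop => hf ?_
    rw [Submodule.restrictScalars_eq_top_iff] at htop
    exact ker_eq_top.mp htop
  obtain ⟨e⟩ := ih (ker f) q hlt fun r => by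
    have := h r
    rw [← trace_lsmul_congr eM, ← trace_lsmul_congr eN, trace_lsmul_prod, trace_lsmul_prod] at this
    exact add_right_cancel this
  exact ⟨eM.symm ≪≫ₗ LinearEquiv.prodCongr e (.refl R _) ≪≫ₗ eN⟩

/-- In characteristic zero, finite-dimensional semisimple modules over an algebra are determined
up to isomorphism by the traces of the action. -/
theorem Module.nonempty_linearEquiv_of_trace_eq [CharZero K]
    [FiniteDimensional K M] [FiniteDimensional K N]
    [IsSemisimpleModule R M] [IsSemisimpleModule R N]
    (h : ∀ r : R, trace K M (Algebra.lsmul K K M r) = trace K N (Algebra.lsmul K K N r)) :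
    Nonempty (M ≃ₗ[R] N) := by
  induction hd : finrank K M using Nat.strong_induction_on generalizing M N with
  | _ d ih =>
  subst hd
  have fin (P : Submodule R M) : FiniteDimensional K P :=
    inferInstanceAs (FiniteDimensional K (P.restrictScalars K))
  have fin' (P : Submodule R N) : FiniteDimensional K P :=
    inferInstanceAs (FiniteDimensional K (P.restrictScalars K))
  have hMN := finrank_eq_of_trace_eq h
  rcases subsingleton_or_nontrivial M with hM | hM
  · have : Subsingleton N := finrank_zero_iff.mp (hMN ▸ finrank_zero_of_subsingleton)
    exact ⟨0⟩
  rcases exists_linearMap_ne_zero_of_trace_eq h with ⟨f, hf⟩ | ⟨g, hg⟩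
  · exact nonempty_linearEquiv_of_linearMap_ne_zero h f hf fun p q hp hpq =>
      ih _ hp hpq rfl
  · have ⟨e⟩ := nonempty_linearEquiv_of_linearMap_ne_zero (fun r => (h r).symm) g hg
      fun p q hp hpq =>
        have ⟨e⟩ := ih _ (by rwa [hMN, ← finrank_eq_of_trace_eq hpq]) (fun r => (hpq r).symm) rfl
        ⟨e.symm⟩
    exact ⟨e.symm⟩

end SemisimpleModule

section Representation

open scoped MonoidAlgebra

theorem Representation.isSemisimpleRepresentation_of_adjoint_mem_range {G V : Type*} [Monoid G]
    [NormedAddCommGroup V] [InnerProductSpace ℂ V] [FiniteDimensional ℂ V]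
    (ρ : Representation ℂ G V) (h : ∀ g, ∃ g', ρ g' = LinearMap.adjoint (ρ g)) :
    ρ.IsSemisimpleRepresentation where
  exists_isCompl p := by
    let q : Subrepresentation ρ := ⟨p.toSubmoduleᗮ, fun g v hv => by
      obtain ⟨g', hg'⟩ := h g
      rw [Submodule.mem_orthogonal] at hv ⊢
      intro u hu
      rw [← LinearMap.adjoint_inner_left, ← hg']
      exact hv _ (p.apply_mem_toSubmodule g' hu)⟩
    have hpq : IsCompl p.toSubmodule q.toSubmodule := Submodule.isCompl_orthogonal _
    refine ⟨q, disjoint_iff.mpr (Subrepresentation.toSubmodule_injective ?_),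
      codisjoint_iff.mpr (Subrepresentation.toSubmodule_injective ?_)⟩
    · exact hpq.inf_eq_bot
    · exact hpq.sup_eq_top

theorem Representation.exists_linearEquiv_of_trace_eq {K G V W : Type*} [Monoid G]
    [Field K] [CharZero K]
    [AddCommGroup V] [Module K V] [FiniteDimensional K V]
    [AddCommGroup W] [Module K W] [FiniteDimensional K W]
    (ρ : Representation K G V) (σ : Representation K G W)
    [hρ : ρ.IsSemisimpleRepresentation] [hσ : σ.IsSemisimpleRepresentation]
    (h : ∀ g, LinearMap.trace K V (ρ g) = LinearMap.trace K W (σ g)) :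
    ∃ e : V ≃ₗ[K] W, ∀ g v, e (ρ g v) = σ g (e v) := by
  have := (isSemisimpleRepresentation_iff_isSemisimpleModule_asModule ρ).mp hρ
  have := (isSemisimpleRepresentation_iff_isSemisimpleModule_asModule σ).mp hσ
  have hV (r : K[G]) : LinearMap.trace K ρ.asModule (Algebra.lsmul K K ρ.asModule r) =
      LinearMap.trace K V (ρ.asAlgebraHom r) := by
    rw [← LinearMap.trace_conj' _ ρ.asModuleEquiv]; rfl
  have hW (r : K[G]) : LinearMap.trace K σ.asModule (Algebra.lsmul K K σ.asModule r) =
      LinearMap.trace K W (σ.asAlgebraHom r) := by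
    rw [← LinearMap.trace_conj' _ σ.asModuleEquiv]; rfl
  obtain ⟨e⟩ := Module.nonempty_linearEquiv_of_trace_eq (K := K) (R := K[G])
    (M := ρ.asModule) (N := σ.asModule) fun r => by
      rw [hV, hW]
      induction r using MonoidAlgebra.induction_linear with
      | zero => simp
      | add x y hx hy => simp only [map_add, hx, hy]
      | single g a => simp [h]
  refine ⟨ρ.asModuleEquiv.symm ≪≫ₗ e.restrictScalars K ≪≫ₗ σ.asModuleEquiv, fun g v => ?_⟩
  change σ.asModuleEquiv (e (ρ.asModuleEquiv.symm (ρ g v))) = _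
  rw [asModuleEquiv_symm_map_rho, map_smul, asModuleEquiv_map_smul, asAlgebraHom_of]
  rfl

end Representation

section Unitary

variable {ι m n : Type*} [Fintype m] [DecidableEq m] [Fintype n] [DecidableEq n]

open scoped MatrixOrder ComplexOrder in
/-- The unitary factor in the polar decomposition of an invertible intertwiner of two families
closed under `ᴴ` is again an intertwiner. -/
theorem Matrix.exists_unitary_intertwiner {X Y : ι → Matrix n n ℂ} {s : ι → ι}
    (hX : ∀ i, X (s i) = (X i)ᴴ) (hY : ∀ i, Y (s i) = (Y i)ᴴ)
    {T : Matrix n n ℂ} (hT : IsUnit T) (hTX : ∀ i, T * X i = Y i * T) :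
    ∃ W : Matrix n n ℂ, Wᴴ * W = 1 ∧ ∀ i, W * X i = Y i * W := by
  have hcomm (i : ι) : Commute (Tᴴ * T) (X i) := by
    have h := congr(($(hTX (s i)))ᴴ)
    simp only [conjTranspose_mul, hX, hY, conjTranspose_conjTranspose] at h
    rw [Commute, SemiconjBy, Matrix.mul_assoc, hTX, ← Matrix.mul_assoc, ← h, Matrix.mul_assoc]
  have hpos : 0 ≤ Tᴴ * T := (posSemidef_conjTranspose_mul_self T).nonneg
  set H := CFC.sqrt (Tᴴ * T) with hH
  have hHH : H * H = Tᴴ * T := CFC.sqrt_mul_sqrt_self _ hpos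
  have hHs : Hᴴ = H := (CFC.sqrt_nonneg (Tᴴ * T)).posSemidef.isHermitian
  have hHu : IsUnit H := (CFC.isUnit_sqrt_iff _ hpos).mpr ((hT.star).mul hT)
  have hHX (i : ι) : Commute H⁻¹ (X i) := by
    have h : Commute H (X i) := by
      rw [hH, CFC.sqrt_eq_cfc]
      exact (hcomm i).cfc_nnreal _
    rw [← hHu.unit_spec, ← coe_units_inv]
    exact Commute.units_inv_left h
  have hdet := (isUnit_iff_isUnit_det H).mp hHu
  refine ⟨T * H⁻¹, ?_, fun i => ?_⟩
  · rw [conjTranspose_mul, conjTranspose_nonsing_inv, hHs, Matrix.mul_assoc, ← Matrix.mul_assoc Tᴴ,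
      ← hHH, Matrix.mul_assoc H, mul_nonsing_inv _ hdet, Matrix.mul_one, nonsing_inv_mul _ hdet]
  · rw [Matrix.mul_assoc, (hHX i).eq, ← Matrix.mul_assoc, hTX, Matrix.mul_assoc]

theorem Matrix.toEuclideanLin_list_prod (w : List (Matrix n n ℂ)) :
    toEuclideanLin w.prod = (w.map toEuclideanLin).prod := by
  exact map_list_prod (toLpLinAlgEquiv (R := ℂ) (n := n) 2) w

theorem Matrix.trace_toEuclideanLin (Z : Matrix n n ℂ) :
    LinearMap.trace ℂ _ (toEuclideanLin Z) = Z.trace := by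
  rw [toEuclideanLin_eq_toLin_orthonormal, trace_toLin_eq]

/-- The **Specht–Wiegmann theorem**: two families of matrices closed under `ᴴ` are simultaneously
unitarily equivalent if all words have the same traces. -/
theorem Matrix.exists_unitary_of_trace_list_prod_eq {X Y : ι → Matrix n n ℂ} {s : ι → ι}
    (hX : ∀ i, X (s i) = (X i)ᴴ) (hY : ∀ i, Y (s i) = (Y i)ᴴ)
    (h : ∀ w : List ι, w ≠ [] → (w.map X).prod.trace = (w.map Y).prod.trace) :
    ∃ W : Matrix n n ℂ, Wᴴ * W = 1 ∧ ∀ i, W * X i = Y i * W := by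
  let ρ (Z : ι → Matrix n n ℂ) : Representation ℂ (FreeMonoid ι) (EuclideanSpace ℂ n) :=
    FreeMonoid.lift fun i => toEuclideanLin (Z i)
  have hρ (Z : ι → Matrix n n ℂ) (w : List ι) :
      ρ Z (FreeMonoid.ofList w) = toEuclideanLin (w.map Z).prod := by
    simp [ρ, toEuclideanLin_list_prod, FreeMonoid.lift_ofList, Function.comp_def]
  have hss (Z : ι → Matrix n n ℂ) (hZ : ∀ i, Z (s i) = (Z i)ᴴ) :
      (ρ Z).IsSemisimpleRepresentation := by
    refine (ρ Z).isSemisimpleRepresentation_of_adjoint_mem_range fun g => ?_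
    refine ⟨.ofList (g.toList.map s).reverse, ?_⟩
    rw [← FreeMonoid.ofList_toList g, hρ, hρ, ← toEuclideanLin_conjTranspose_eq_adjoint,
      conjTranspose_list_prod]
    simp [Function.comp_def, hZ]
  have := hss X hX
  have := hss Y hY
  obtain ⟨e, he⟩ := (ρ X).exists_linearEquiv_of_trace_eq (ρ Y) fun g => by
    rw [← FreeMonoid.ofList_toList g, hρ, hρ]
    rcases eq_or_ne g.toList [] with hg | hg
    · rw [hg]; simp
    · rw [trace_toEuclideanLin, trace_toEuclideanLin, h _ hg]
  refine exists_unitary_intertwiner hX hY (T := toEuclideanLin.symm e) ?_ fun i => ?_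
  · exact ((Module.End.isUnit_iff _).mpr e.bijective).map (toLpLinAlgEquiv (R := ℂ) (n := n) 2).symm
  · apply toEuclideanLin.injective
    rw [toLpLin_mul _ 2, toLpLin_mul _ 2, LinearEquiv.apply_symm_apply]
    ext1 v
    simpa [ρ] using he (.of i) v

/-- Matrices with the same Gram matrix differ by a unitary factor. -/
theorem Matrix.exists_unitary_mul_eq_of_conjTranspose_mul_self_eq {A B : Matrix m n ℂ}
    (h : Aᴴ * A = Bᴴ * B) : ∃ U : Matrix m m ℂ, Uᴴ * U = 1 ∧ U * A = B := by
  set a := toEuclideanLin A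
  set b := toEuclideanLin B
  have hab : LinearMap.adjoint a ∘ₗ a = LinearMap.adjoint b ∘ₗ b := by
    simp only [a, b, ← toEuclideanLin_conjTranspose_eq_adjoint]
    rw [← toLpLin_mul, ← toLpLin_mul, h]
  have hnorm (x) : ‖a x‖ = ‖b x‖ := by
    have := congr(inner ℂ ($hab x) x)
    simp only [LinearMap.comp_apply, LinearMap.adjoint_inner_left] at this
    rw [@norm_eq_sqrt_re_inner ℂ, @norm_eq_sqrt_re_inner ℂ, this]
  obtain ⟨g, hg⟩ := a.rangeRestrict.exists_rightInverse_of_surjective a.range_rangeRestrict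
  have hg' (y) : a (g y) = y := congr(($hg y : EuclideanSpace ℂ m))
  let L : LinearMap.range a →ₗᵢ[ℂ] EuclideanSpace ℂ m :=
    ⟨b ∘ₗ g, fun y => by simp [← hnorm, hg']⟩
  have hL (x) : L.extend (a x) = b x := by
    have := L.extend_apply ⟨a x, x, rfl⟩
    rw [this]
    change b (g _) = b x
    rw [← sub_eq_zero, ← map_sub, ← norm_eq_zero, ← hnorm, map_sub, hg', sub_self, norm_zero]
  refine ⟨toEuclideanLin.symm L.extend.toLinearMap, ?_, ?_⟩
  · apply toEuclideanLin.injective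
    rw [toLpLin_mul _ 2, toEuclideanLin_conjTranspose_eq_adjoint, LinearEquiv.apply_symm_apply]
    ext1 x
    simp
  · apply toEuclideanLin.injective
    rw [toLpLin_mul _ 2, LinearEquiv.apply_symm_apply]
    ext1 x
    exact hL x

end Unitary

/-- **Jing's criterion for simultaneous unitary equivalence.**
Two `k`-tuples `(A₁, …, A_k)` and `(B₁, …, B_k)` of `m × n` complex matrices satisfy
`U * Aᵢ * V = Bᵢ` for some unitary `U` (of size `m × m`) and `V` (of size `n × n`) iff
`trace w(A₁ᴴA₁, …, Aᵢᴴ Aⱼ, …, A_kᴴA_k) = trace w(B₁ᴴB₁, …, Bᵢᴴ Bⱼ, …, B_kᴴB_k)` for every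
word `w` in `k²` noncommuting variables.  A word is encoded as a nonempty list of index
pairs `(i, j)`, the pair `(i, j)` standing for the variable evaluated at `Aᵢᴴ * Aⱼ`. -/
theorem jing_simultaneous_unitary_equivalence (m n k : ℕ)
    (A B : Fin k → Matrix (Fin m) (Fin n) ℂ) :
    (∃ (U : Matrix (Fin m) (Fin m) ℂ) (V : Matrix (Fin n) (Fin n) ℂ),
      Uᴴ * U = 1 ∧ Vᴴ * V = 1 ∧ ∀ i : Fin k, U * A i * V = B i) ↔
    (∀ w : List (Fin k × Fin k), w ≠ [] →
      ((w.map fun p => (A p.1)ᴴ * A p.2).prod).trace =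
      ((w.map fun p => (B p.1)ᴴ * B p.2).prod).trace) := by
  constructor
  · rintro ⟨U, V, hU, hV, h⟩ w -
    have hV' : V * Vᴴ = 1 := mul_eq_one_comm.mp hV
    have hB (p : Fin k × Fin k) : (B p.1)ᴴ * B p.2 = Vᴴ * ((A p.1)ᴴ * A p.2) * V := by
      rw [← h, ← h]
      simp only [conjTranspose_mul, Matrix.mul_assoc]
      rw [← Matrix.mul_assoc Uᴴ, hU, Matrix.one_mul]
    have hw : (w.map fun p => (B p.1)ᴴ * B p.2).prod =
        Vᴴ * (w.map fun p => (A p.1)ᴴ * A p.2).prod * V := by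
      induction w with
      | nil => simp [hV]
      | cons p w ih =>
        rw [List.map_cons, List.prod_cons, List.map_cons, List.prod_cons, ih, hB]
        simp only [Matrix.mul_assoc]
        rw [← Matrix.mul_assoc V, hV', Matrix.one_mul]
    rw [hw, trace_mul_comm, ← Matrix.mul_assoc, hV', Matrix.one_mul]
  · intro h
    obtain ⟨W, hW, hWA⟩ := exists_unitary_of_trace_list_prod_eq (s := Prod.swap)
      (fun p => by simp) (fun p => by simp) h
    have hW' : W * Wᴴ = 1 := mul_eq_one_comm.mp hW
    have hG (i j : Fin k) : (A i * Wᴴ)ᴴ * (A j * Wᴴ) = (B i)ᴴ * B j := by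
      simp only [conjTranspose_mul, conjTranspose_conjTranspose]
      rw [← Matrix.mul_assoc, Matrix.mul_assoc W, hWA (i, j), Matrix.mul_assoc, hW', Matrix.mul_one]
    obtain ⟨U, hU, hUA⟩ := exists_unitary_mul_eq_of_conjTranspose_mul_self_eq
      (A := .of fun i (p : Fin k × Fin n) => (A p.1 * Wᴴ) i p.2)
      (B := .of fun i (p : Fin k × Fin n) => B p.1 i p.2) <| by
        ext p q
        exact congr($(hG p.1 q.1) p.2 q.2)
    refine ⟨U, Wᴴ, hU, by simpa using hW', fun i => ?_⟩
    ext a b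
    rw [Matrix.mul_assoc]
    exact congr($hUA a (i, b))
end

section
/- Let Q be a quiver with finitely many vertices 1,…,t and finitely many arrows, let m_{ij} denote the number of arrows from vertex j to vertex i, and let r be the minimal natural number with r(r+1)/2 ≥ max_{i,j} m_{ij}. Let A and B be complex matrix representations of Q of the same dimension (d₁,…,d_t). If trace Ã(π) = trace B̃(π) for every oriented cycle π in the doubled quiver Q̃ of length at most ((r+2)(d₁+⋯+d_t))², where Ã assigns A_α to each original arrow α and A_αᴴ to each reversed arrow α*, then A and B are unitarily isometric, i.e., there exist unitary matrices U₁,…,U_t with B_α = U_v⁻¹ A_α U_u for every arrow α: u → v. -/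
open Matrix Quiver

/-- The product of the matrices assigned by a matrix representation `A` along a directed
path. -/
noncomputable def pathMatrixC {V : Type} [Quiver V] (d : V → ℕ)
    (A : ∀ u v : V, (u ⟶ v) → Matrix (Fin (d v)) (Fin (d u)) ℂ) :
    ∀ {u v : V}, Path u v → Matrix (Fin (d v)) (Fin (d u)) ℂ
  | _, _, Path.nil => 1
  | _, _, Path.cons p e => A _ _ e * pathMatrixC d A p

/-- The matrix representation of the doubled quiver `Symmetrify V` induced by a matrix
representation `A` of `V`: original arrows keep their matrices, and each reversed arrow
gets the conjugate transpose of the matrix of the corresponding original arrow. -/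
noncomputable def doubledRepH {V : Type} [Quiver V] (d : V → ℕ)
    (A : ∀ u v : V, (u ⟶ v) → Matrix (Fin (d v)) (Fin (d u)) ℂ) :
    ∀ u v : Symmetrify V, (u ⟶ v) → Matrix (Fin (d v)) (Fin (d u)) ℂ :=
  fun _ _ e => match e with
    | Sum.inl a => A _ _ a
    | Sum.inr a => (A _ _ a)ᴴ

section Specht

open scoped ComplexOrder

variable {n : Type*} [Fintype n] [DecidableEq n]

theorem Matrix.self_mul_conjTranspose_mul_self_of_idem {W : Matrix n n ℂ}
    (h : Wᴴ * W * (Wᴴ * W) = Wᴴ * W) : W * (Wᴴ * W) = W := by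
  rw [← sub_eq_zero, ← Matrix.conjTranspose_mul_self_eq_zero]
  have h' : Wᴴ * W * Wᴴ * W = Wᴴ * W := by simpa only [mul_assoc] using h
  simp [conjTranspose_sub, conjTranspose_mul, sub_mul, mul_sub, ← mul_assoc, h']

/-- The partial isometry in the polar decomposition of `T`, as `T` times a matrix commuting with
everything that commutes with `Tᴴ * T`. -/
theorem Matrix.exists_partialIsometry_eq_mul (T : Matrix n n ℂ) (hT : T ≠ 0) :
    ∃ c : Matrix n n ℂ, (∀ x, Commute (Tᴴ * T) x → Commute c x) ∧ T * c ≠ 0 ∧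
      (T * c)ᴴ * (T * c) * ((T * c)ᴴ * (T * c)) = (T * c)ᴴ * (T * c) := by
  set H := Tᴴ * T with hH
  have hHs : IsSelfAdjoint H := isHermitian_conjTranspose_mul_self T
  have hcont (f : ℝ → ℝ) : ContinuousOn f (spectrum ℝ H) :=
    (Matrix.finite_real_spectrum (A := H)).continuousOn f
  have hnn : ∀ x ∈ spectrum ℝ H, 0 ≤ x := by
    intro x hx
    have hp : H.PosSemidef := posSemidef_conjTranspose_mul_self T
    rw [hp.1.spectrum_real_eq_range_eigenvalues] at hx
    obtain ⟨i, rfl⟩ := hx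
    exact hp.eigenvalues_nonneg i
  let g : ℝ → ℝ := fun x => (√x)⁻¹
  set c := cfc g H with hc
  have hcs : cᴴ = c := (cfc_predicate g H : IsSelfAdjoint c)
  have hcfc : (T * c)ᴴ * (T * c) = cfc (fun x => g x * (x * g x)) H := by
    rw [cfc_mul _ _ _ (hcont _) (hcont _), cfc_mul _ _ _ (hcont _) (hcont _), cfc_id' ℝ H,
      conjTranspose_mul, hcs, hH]
    simp only [hc, hH, mul_assoc]
  refine ⟨c, fun x hx => hx.cfc_real g, fun h0 => hT ?_, ?_⟩
  · have : H = H * ((T * c)ᴴ * (T * c)) := by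
      rw [hcfc]
      nth_rw 1 2 [← cfc_id' ℝ H]
      rw [← cfc_mul _ _ _ (hcont _) (hcont _)]
      refine cfc_congr fun x hx => ?_
      rcases (hnn x hx).eq_or_lt with h | h
      · simp [← h]
      · have := Real.sqrt_ne_zero'.2 h
        simp only [g]
        field_simp
        rw [Real.sq_sqrt h.le]
    rw [h0, mul_zero, mul_zero, hH] at this
    exact conjTranspose_mul_self_eq_zero.1 this
  · rw [hcfc, ← cfc_mul _ _ _ (hcont _) (hcont _)]
    refine cfc_congr fun x hx => ?_
    rcases (hnn x hx).eq_or_lt with h | h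
    · simp [← h]
    · have := Real.sqrt_ne_zero'.2 h
      simp only [g]
      have h1 : (√x)⁻¹ * (x * (√x)⁻¹) = 1 := by
        field_simp
        rw [Real.sq_sqrt h.le]
      simp [h1]

theorem exists_intertwiner {S : Submodule ℂ (Matrix n n ℂ × Matrix n n ℂ)}
    (hmul : ∀ x ∈ S, ∀ y ∈ S, x * y ∈ S) (hstar : ∀ x ∈ S, star x ∈ S)
    (htr : ∀ x ∈ S, x.1.trace = x.2.trace) {e : Matrix n n ℂ × Matrix n n ℂ} (he : e ∈ S)
    (hleft : ∀ x ∈ S, e * x = x) (he0 : e ≠ 0) :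
    ∃ T : Matrix n n ℂ, T ≠ 0 ∧ e.2 * T = T ∧ ∀ x ∈ S, T * x.1 = x.2 * T := by
  have hfst : ∀ x ∈ S, x.1 = 0 → x = 0 := by
    intro x hx h
    have h1 := htr _ (hmul _ (hstar x hx) _ hx)
    simp only [Prod.fst_mul, h, mul_zero, trace_zero, Prod.snd_mul, Prod.snd_star,
      star_eq_conjTranspose] at h1
    exact Prod.ext h (trace_conjTranspose_mul_self_eq_zero_iff.1 h1.symm)
  have hsnd : ∀ x ∈ S, x.2 = 0 → x = 0 := by
    intro x hx h
    have h1 := htr _ (hmul _ (hstar x hx) _ hx)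
    simp only [Prod.snd_mul, h, mul_zero, trace_zero, Prod.fst_mul, Prod.fst_star,
      star_eq_conjTranspose] at h1
    exact Prod.ext (trace_conjTranspose_mul_self_eq_zero_iff.1 h1) h
  let β : LinearMap.BilinForm ℂ S := LinearMap.mk₂ ℂ (fun x y => (x.1.1 * y.1.1).trace)
    (by intros; simp [add_mul]) (by intros; simp) (by intros; simp [mul_add]) (by intros; simp)
  have hβ (x y : S) : β x y = (x.1.1 * y.1.1).trace := rfl
  have hsymm : β.IsSymm := ⟨fun x y => by simp [hβ, trace_mul_comm x.1.1]⟩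
  have hnd : β.Nondegenerate := by
    refine (LinearMap.BilinForm.IsSymm.isRefl hsymm).nondegenerate_iff_separatingLeft.2 ?_
    intro x hx
    have h1 := hx ⟨_, hstar _ x.2⟩
    rw [hβ, trace_mul_comm] at h1
    exact Subtype.ext (hfst _ x.2 (trace_conjTranspose_mul_self_eq_zero_iff.1 h1))
  let b := Module.finBasis ℂ S
  let b' := β.dualBasis hnd b
  have hexp (z : S) : z = ∑ i, β z (b' i) • b i := by
    have h := (β.dualBasis hnd b').sum_repr z
    simp only [LinearMap.BilinForm.dualBasis_repr_apply] at h
    rw [LinearMap.BilinForm.dualBasis_dualBasis hnd hsymm] at h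
    exact h.symm
  have hexp' (z : S) : z = ∑ i, β z (b i) • b' i := by
    conv_lhs => rw [← b'.sum_repr z]
    simp [b', LinearMap.BilinForm.dualBasis_repr_apply]
  let T (Y : Matrix n n ℂ) : Matrix n n ℂ := ∑ i, (b i).1.2 * Y * (b' i).1.1
  have hT (Y : Matrix n n ℂ) : ∀ x ∈ S, T Y * x.1 = x.2 * T Y := by
    intro x hx
    have h1 (i) : (b' i).1.1 * x.1 =
        ∑ j, ((b' i).1.1 * x.1 * (b j).1.1).trace • (b' j).1.1 := by
      have := congrArg (fun z : S => z.1.1) (hexp' ⟨_, hmul _ (b' i).2 _ hx⟩)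
      simpa [hβ, Submodule.coe_sum, Prod.fst_sum] using this
    have h2 (j) : x.2 * (b j).1.2 =
        ∑ i, ((b' i).1.1 * x.1 * (b j).1.1).trace • (b i).1.2 := by
      have := congrArg (fun z : S => z.1.2) (hexp ⟨_, hmul _ hx _ (b j).2⟩)
      simp only [hβ, Submodule.coe_sum, Prod.snd_sum, Prod.snd_mul, Prod.fst_mul,
        Submodule.coe_smul, Prod.smul_snd] at this
      rw [this]
      refine Finset.sum_congr rfl fun i _ => ?_
      rw [trace_mul_comm, mul_assoc]
    calc T Y * x.1 = ∑ i, (b i).1.2 * Y * ((b' i).1.1 * x.1) := by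
          simp [T, Finset.sum_mul, mul_assoc]
      _ = ∑ i, ∑ j, ((b' i).1.1 * x.1 * (b j).1.1).trace • ((b i).1.2 * Y * (b' j).1.1) := by
          refine Finset.sum_congr rfl fun i _ => ?_
          conv_lhs => rw [h1, Finset.mul_sum]
          simp
      _ = ∑ j, (x.2 * (b j).1.2) * Y * (b' j).1.1 := by
          rw [Finset.sum_comm]
          refine Finset.sum_congr rfl fun j _ => ?_
          rw [h2, Finset.sum_mul, Finset.sum_mul]
          simp
      _ = x.2 * T Y := by simp [T, Finset.mul_sum, mul_assoc]
  have hTe (Y : Matrix n n ℂ) : e.2 * T Y = T Y := by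
    simp only [T, Finset.mul_sum, ← mul_assoc]
    refine Finset.sum_congr rfl fun i _ => ?_
    rw [show e.2 * (b i).1.2 = (b i).1.2 from congrArg Prod.snd (hleft _ (b i).2)]
  by_contra! hcon
  have hT0 (Y : Matrix n n ℂ) : T Y = 0 := by
    by_contra h
    obtain ⟨x, hx, h'⟩ := hcon _ h (hTe Y)
    exact h' (hT Y x hx)
  refine he0 (hsnd e he ?_)
  ext a k
  have h1 : e.2 a k = ∑ i, (e.1 * (b' i).1.1).trace * (b i).1.2 a k := by
    have := congrArg (fun z : S => z.1.2 a k) (hexp ⟨_, he⟩)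
    simpa [hβ, Submodule.coe_sum, Prod.snd_sum, Matrix.sum_apply] using this
  have h2 (l d) : ∑ i, (b i).1.2 a k * (b' i).1.1 l d = 0 := by
    have := congrFun (congrFun (hT0 (Matrix.single k l 1)) a) d
    simpa [T, Matrix.sum_apply, Matrix.mul_apply, Matrix.single_apply, ite_and, Finset.sum_ite_eq]
      using this
  have h3 : e.2 a k = ∑ d, ∑ l, e.1 d l * ∑ i, (b i).1.2 a k * (b' i).1.1 l d := by
    rw [h1]
    simp only [trace, diag_apply, Matrix.mul_apply, Finset.sum_mul, Finset.mul_sum]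
    rw [Finset.sum_comm]
    refine Finset.sum_congr rfl fun d _ => ?_
    rw [Finset.sum_comm]
    refine Finset.sum_congr rfl fun l _ => Finset.sum_congr rfl fun i _ => ?_
    ring
  rw [h3]
  simp [h2]

/-- Specht's theorem, in a form suited to induction: `S` is a trace-compatible `*`-algebra of pairs
of matrices whose unit `e` is a pair of projections. -/
theorem exists_partialIsometry_intertwining {S : Submodule ℂ (Matrix n n ℂ × Matrix n n ℂ)}
    (hmul : ∀ x ∈ S, ∀ y ∈ S, x * y ∈ S) (hstar : ∀ x ∈ S, star x ∈ S)
    (htr : ∀ x ∈ S, x.1.trace = x.2.trace) {e : Matrix n n ℂ × Matrix n n ℂ} (he : e ∈ S)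
    (hes : star e = e) (hleft : ∀ x ∈ S, e * x = x) :
    ∃ W : Matrix n n ℂ, Wᴴ * W = e.1 ∧ W * Wᴴ = e.2 ∧ ∀ x ∈ S, W * x.1 = x.2 * W := by
  induction hN : Module.finrank ℂ (LinearMap.range (toLin' e.1)) using Nat.strong_induction_on
    generalizing S e with
  | _ N ih =>
  subst hN
  have hright : ∀ x ∈ S, x * e = x := fun x hx => by
    have := congrArg star (hleft _ (hstar x hx))
    rwa [star_mul, star_star, hes] at this
  rcases eq_or_ne e 0 with rfl | he0
  · refine ⟨0, by simp, by simp, fun x hx => by simp⟩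
  obtain ⟨T, hT0, heT, hT⟩ := exists_intertwiner hmul hstar htr he hleft he0
  have hT' : ∀ x ∈ S, Tᴴ * x.2 = x.1 * Tᴴ := fun x hx => by
    have := congrArg conjTranspose (hT _ (hstar x hx))
    simpa [star_eq_conjTranspose] using this.symm
  obtain ⟨c, hc, hW0, hWW⟩ := Matrix.exists_partialIsometry_eq_mul T hT0
  set W := T * c with hWdef
  have hW : ∀ x ∈ S, W * x.1 = x.2 * W := fun x hx => by
    have h1 : Commute (Tᴴ * T) x.1 := by
      rw [commute_iff_eq, mul_assoc, hT x hx, ← mul_assoc, hT' x hx, mul_assoc]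
    rw [hWdef, mul_assoc, (hc _ h1).eq, ← mul_assoc, hT x hx, mul_assoc]
  have hW' : ∀ x ∈ S, Wᴴ * x.2 = x.1 * Wᴴ := fun x hx => by
    have := congrArg conjTranspose (hW _ (hstar x hx))
    simpa [star_eq_conjTranspose] using this.symm
  have heW : e.2 * W = W := by rw [hWdef, ← mul_assoc, heT]
  have hWe : W * e.1 = W := by rw [hW e he, heW]
  have hWW' := Matrix.self_mul_conjTranspose_mul_self_of_idem hWW
  set E : Matrix n n ℂ × Matrix n n ℂ := (Wᴴ * W, W * Wᴴ) with hE
  have hEs : star E = E := by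
    ext1 <;> simp [hE, star_eq_conjTranspose]
  have hEE : E * E = E := by
    ext1
    · exact hWW
    · change W * Wᴴ * (W * Wᴴ) = W * Wᴴ
      rw [← mul_assoc, mul_assoc W, hWW']
  have hEx : ∀ x ∈ S, E * x = x * E := fun x hx => by
    ext1
    · change Wᴴ * W * x.1 = x.1 * (Wᴴ * W)
      rw [mul_assoc, hW x hx, ← mul_assoc, hW' x hx, mul_assoc]
    · change W * Wᴴ * x.2 = x.2 * (W * Wᴴ)
      rw [mul_assoc, hW' x hx, ← mul_assoc, hW x hx, mul_assoc]
  have hEe : E * e = E := by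
    ext1
    · change Wᴴ * W * e.1 = Wᴴ * W
      rw [mul_assoc, hWe]
    · change W * Wᴴ * e.2 = W * Wᴴ
      rw [mul_assoc, hW' e he, ← mul_assoc, hWe]
  have heE : e * E = E := by rw [← hEx e he, hEe]
  have hee : e * e = e := hleft e he
  set e' := e - E with he'
  have hes' : star e' = e' := by rw [he', star_sub, hes, hEs]
  have hee' : e' * e' = e' := by
    rw [he', sub_mul, mul_sub, mul_sub, hee, heE, hEe, hEE, sub_self, sub_zero]
  have hee'' : e * e' = e' := by rw [he', mul_sub, hee, heE]
  have hex' : ∀ x ∈ S, e' * x = x * e' := fun x hx => by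
    rw [he', sub_mul, mul_sub, hleft x hx, hright x hx, hEx x hx]
  have hrank : Module.finrank ℂ (LinearMap.range (toLin' e'.1)) <
      Module.finrank ℂ (LinearMap.range (toLin' e.1)) := by
    refine Submodule.finrank_lt_finrank_of_lt (lt_of_le_of_ne ?_ fun heq => hW0 ?_)
    · have h1 : e'.1 = e.1 * e'.1 := (congrArg Prod.fst hee'').symm
      rw [h1, toLin'_mul]
      exact LinearMap.range_comp_le_range _ _
    · have h1 : e'.1 * e.1 = e.1 := by
        refine toLin'.injective (LinearMap.ext fun v => ?_)
        have hv : toLin' e.1 v ∈ LinearMap.range (toLin' e'.1) := heq ▸ LinearMap.mem_range_self _ v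
        obtain ⟨w, hw⟩ := hv
        rw [toLin'_mul, LinearMap.comp_apply, ← hw, ← LinearMap.comp_apply, ← toLin'_mul]
        exact congrArg (fun M => toLin' M w) (congrArg Prod.fst hee')
      have h2 : (e * e').1 = (e' * e).1 := congrArg Prod.fst (hex' e he).symm
      rw [hee'', Prod.fst_mul, h1] at h2
      have h3 : Wᴴ * W = 0 := by
        have : e.1 - Wᴴ * W = e.1 := h2
        simpa using this
      exact conjTranspose_mul_self_eq_zero.1 h3
  obtain ⟨W', h1, h2, h3⟩ := ih _ hrank (S := S.map (LinearMap.mulLeft ℂ e')) (e := e')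
    (by
      rintro _ ⟨x, hx, rfl⟩ _ ⟨y, hy, rfl⟩
      refine ⟨x * y, hmul x hx y hy, ?_⟩
      simp only [LinearMap.mulLeft_apply]
      rw [mul_assoc e' x, ← mul_assoc x, ← hex' x hx, mul_assoc e' x, ← mul_assoc e' e', hee'])
    (by
      rintro _ ⟨x, hx, rfl⟩
      refine ⟨star x, hstar x hx, ?_⟩
      simp only [LinearMap.mulLeft_apply, star_mul]
      rw [hes', hex' _ (hstar x hx)])
    (by
      rintro _ ⟨x, hx, rfl⟩
      have ht : (Wᴴ * W * x.1).trace = (W * Wᴴ * x.2).trace := by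
        rw [mul_assoc, hW x hx, trace_mul_comm, mul_assoc, trace_mul_comm]
      have hl : e' * x = x - E * x := by rw [he', sub_mul, hleft x hx]
      simp only [LinearMap.mulLeft_apply, hl]
      simp only [Prod.fst_sub, Prod.snd_sub, trace_sub, htr x hx, Prod.fst_mul, Prod.snd_mul]
      rw [← ht])
    ⟨e, he, by simp only [LinearMap.mulLeft_apply]; rw [hex' e he, hee'']⟩ hes'
    (by
      rintro _ ⟨x, hx, rfl⟩
      simp only [LinearMap.mulLeft_apply]
      rw [← mul_assoc, hee'])
    rfl
  have hW'e : W' * e'.1 = W' := by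
    rw [← h1]
    refine Matrix.self_mul_conjTranspose_mul_self_of_idem ?_
    rw [h1]
    exact congrArg Prod.fst hee'
  have heW' : e'.2 * W' = W' := by rw [← h2, mul_assoc, h1, hW'e]
  have hWe' : Wᴴ * e'.2 = 0 := by
    change Wᴴ * (e.2 - W * Wᴴ) = 0
    rw [mul_sub, hW' e he, ← mul_assoc, sub_eq_zero]
    have := congrArg conjTranspose hWW'
    have h4 := congrArg conjTranspose hWe
    have h5 : e.1ᴴ = e.1 := congrArg Prod.fst hes
    rw [conjTranspose_mul, h5] at h4
    rw [h4]
    simpa [mul_assoc] using this.symm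
  have hWe1 : W * e'.1 = 0 := by
    change W * (e.1 - Wᴴ * W) = 0
    rw [mul_sub, hWe, hWW', sub_self]
  have hc1 : Wᴴ * W' = 0 := by rw [← heW', ← mul_assoc, hWe', zero_mul]
  have hc2 : W'ᴴ * W = 0 := by
    have := congrArg conjTranspose hc1
    simpa using this
  have hc3 : W * W'ᴴ = 0 := by
    have h5 : e'.1ᴴ = e'.1 := congrArg Prod.fst hes'
    rw [← hW'e, conjTranspose_mul, h5, ← mul_assoc, hWe1, zero_mul]
  have hc4 : W' * Wᴴ = 0 := by
    have := congrArg conjTranspose hc3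
    simpa using this
  refine ⟨W + W', ?_, ?_, fun x hx => ?_⟩
  · rw [conjTranspose_add, add_mul, mul_add, mul_add, hc1, hc2, h1, add_zero, zero_add]
    exact add_sub_cancel (Wᴴ * W) e.1
  · rw [conjTranspose_add, add_mul, mul_add, mul_add, hc3, hc4, h2, add_zero, zero_add]
    exact add_sub_cancel (W * Wᴴ) e.2
  · have h4 := h3 _ (Submodule.mem_map_of_mem hx)
    have h5 : x.2 * e'.2 = e'.2 * x.2 := (congrArg Prod.snd (hex' x hx)).symm
    simp only [LinearMap.mulLeft_apply, Prod.fst_mul, Prod.snd_mul] at h4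
    rw [← mul_assoc, hW'e, ← h5, mul_assoc, heW'] at h4
    rw [add_mul, mul_add, hW x hx, h4]

end Specht

section VertexInclusion

variable {V : Type} [DecidableEq V]

/-- The inclusion of the space at the vertex `v` into the direct sum over all vertices. -/
def vertexIncl (d : V → ℕ) (v : V) : Matrix (Σ v, Fin (d v)) (Fin (d v)) ℂ :=
  fun i a => if i = ⟨v, a⟩ then 1 else 0

variable [Fintype V] {d : V → ℕ}

theorem vertexIncl_conjTranspose_mul_self (v : V) :
    (vertexIncl d v)ᴴ * vertexIncl d v = 1 := by
  ext a b
  simp only [vertexIncl, Matrix.mul_apply, Matrix.one_apply, conjTranspose_apply]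
  by_cases h : a = b
  · simp [h, apply_ite]
  · simp [h, Ne.symm h, apply_ite]

theorem vertexIncl_conjTranspose_mul_of_ne {u v : V} (h : u ≠ v) :
    (vertexIncl d u)ᴴ * vertexIncl d v = 0 := by
  ext a b
  simp [vertexIncl, Matrix.mul_apply, apply_ite, h.symm]

theorem sum_vertexIncl_mul_conjTranspose :
    ∑ v, vertexIncl d v * (vertexIncl d v)ᴴ = 1 := by
  ext i j
  simp only [vertexIncl, Matrix.sum_apply, Matrix.mul_apply, Matrix.one_apply, conjTranspose_apply]
  rw [← Fintype.sum_sigma (fun k : Σ v, Fin (d v) =>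
    (if i = k then (1 : ℂ) else 0) * star (if j = k then (1 : ℂ) else 0))]
  simp

theorem vertexIncl_mul_mul_mul {u v w : V} (M : Matrix (Fin (d w)) (Fin (d v)) ℂ)
    (N : Matrix (Fin (d v)) (Fin (d u)) ℂ) :
    vertexIncl d w * M * (vertexIncl d v)ᴴ * (vertexIncl d v * N * (vertexIncl d u)ᴴ) =
      vertexIncl d w * (M * N) * (vertexIncl d u)ᴴ := by
  simp only [Matrix.mul_assoc]
  rw [← Matrix.mul_assoc (vertexIncl d v)ᴴ, vertexIncl_conjTranspose_mul_self, Matrix.one_mul]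

end VertexInclusion

section QuiverPaths

open scoped ComplexOrder

variable {V : Type} [Quiver V] {d : V → ℕ}

theorem pathMatrixC_comp (A : ∀ u v : V, (u ⟶ v) → Matrix (Fin (d v)) (Fin (d u)) ℂ)
    {u v w : V} (p : Path u v) (q : Path v w) :
    pathMatrixC d A (p.comp q) = pathMatrixC d A q * pathMatrixC d A p := by
  induction q with
  | nil => simp [pathMatrixC]
  | cons q e ih => simp only [Path.comp_cons, pathMatrixC, ih, Matrix.mul_assoc]

theorem pathMatrixC_reverse [HasReverse V]
    {A : ∀ u v : V, (u ⟶ v) → Matrix (Fin (d v)) (Fin (d u)) ℂ}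
    (hA : ∀ (u v : V) (e : u ⟶ v), A v u (reverse e) = (A u v e)ᴴ) {u v : V} (p : Path u v) :
    pathMatrixC d A p.reverse = (pathMatrixC d A p)ᴴ := by
  induction p with
  | nil => simp [pathMatrixC, Path.reverse]
  | cons p e ih =>
    simp [Path.reverse, pathMatrixC_comp, ih, pathMatrixC, Hom.toPath, hA]

theorem path_length_reverse [HasReverse V] {u v : V} (p : Path u v) : p.reverse.length = p.length := by
  induction p with
  | nil => rfl
  | cons p e ih => simp [Path.reverse, ih, add_comm, Path.length_comp]

variable [DecidableEq V]

variable (A B : ∀ u v : V, (u ⟶ v) → Matrix (Fin (d v)) (Fin (d u)) ℂ)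

/-- The pair of block matrices on the direct sum of all vertex spaces that a path determines in the
representations `A` and `B`. -/
noncomputable def pathPair {u v : V} (p : Path u v) :
    Matrix (Σ v, Fin (d v)) (Σ v, Fin (d v)) ℂ × Matrix (Σ v, Fin (d v)) (Σ v, Fin (d v)) ℂ :=
  (vertexIncl d v * pathMatrixC d A p * (vertexIncl d u)ᴴ,
    vertexIncl d v * pathMatrixC d B p * (vertexIncl d u)ᴴ)

theorem pathPair_mul [Fintype V] {u v w : V} (q : Path v w) (p : Path u v) :
    pathPair A B q * pathPair A B p = pathPair A B (p.comp q) := by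
  simp only [pathPair, Prod.mk_mul_mk, vertexIncl_mul_mul_mul, pathMatrixC_comp]

theorem pathPair_mul_of_ne [Fintype V] {u v v' w : V} (h : v' ≠ v) (q : Path v' w) (p : Path u v) :
    pathPair A B q * pathPair A B p = 0 := by
  have h1 (M : Matrix (Fin (d w)) (Fin (d v')) ℂ) (N : Matrix (Fin (d v)) (Fin (d u)) ℂ) :
      vertexIncl d w * M * (vertexIncl d v')ᴴ * (vertexIncl d v * N * (vertexIncl d u)ᴴ) = 0 := by
    rw [Matrix.mul_assoc _ (vertexIncl d v')ᴴ, ← Matrix.mul_assoc (vertexIncl d v')ᴴ,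
      ← Matrix.mul_assoc (vertexIncl d v')ᴴ, vertexIncl_conjTranspose_mul_of_ne h]
    simp
  simp only [pathPair, Prod.mk_mul_mk, h1, Prod.mk_zero_zero]

/-- The span of the pairs of block matrices along paths of length at most `k`. -/
noncomputable def pathSpan (k : ℕ) : Submodule ℂ
    (Matrix (Σ v, Fin (d v)) (Σ v, Fin (d v)) ℂ × Matrix (Σ v, Fin (d v)) (Σ v, Fin (d v)) ℂ) :=
  Submodule.span ℂ {x | ∃ (u v : V) (p : Path u v), p.length ≤ k ∧ pathPair A B p = x}

variable {A B}

theorem pathPair_mem {k : ℕ} {u v : V} (p : Path u v) (h : p.length ≤ k) :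
    pathPair A B p ∈ pathSpan A B k :=
  Submodule.subset_span ⟨u, v, p, h, rfl⟩

theorem pathSpan_mono : Monotone (pathSpan A B) := fun _ _ h =>
  Submodule.span_mono fun _ ⟨u, v, p, hp, hx⟩ => ⟨u, v, p, hp.trans h, hx⟩

theorem star_mem_pathSpan [HasReverse V]
    (hA : ∀ (u v : V) (e : u ⟶ v), A v u (reverse e) = (A u v e)ᴴ)
    (hB : ∀ (u v : V) (e : u ⟶ v), B v u (reverse e) = (B u v e)ᴴ) {k : ℕ}
    {x : Matrix (Σ v, Fin (d v)) (Σ v, Fin (d v)) ℂ × Matrix (Σ v, Fin (d v)) (Σ v, Fin (d v)) ℂ}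
    (hx : x ∈ pathSpan A B k) : star x ∈ pathSpan A B k := by
  induction hx using Submodule.span_induction with
  | mem x hx =>
    obtain ⟨u, v, p, hp, rfl⟩ := hx
    have h : star (pathPair A B p) = pathPair A B p.reverse := by
      ext1 <;> simp [pathPair, pathMatrixC_reverse hA, pathMatrixC_reverse hB,
        star_eq_conjTranspose, Matrix.mul_assoc]
    rw [h]
    exact pathPair_mem _ (by rwa [path_length_reverse])
  | zero => simp
  | add x y _ _ hx hy => simpa only [star_add] using add_mem hx hy
  | smul c x _ hx => simpa only [star_smul] using Submodule.smul_mem _ _ hx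

variable [Fintype V]

theorem mul_mem_pathSpan {k l : ℕ}
    {x y : Matrix (Σ v, Fin (d v)) (Σ v, Fin (d v)) ℂ × Matrix (Σ v, Fin (d v)) (Σ v, Fin (d v)) ℂ}
    (hx : x ∈ pathSpan A B k) (hy : y ∈ pathSpan A B l) : x * y ∈ pathSpan A B (k + l) := by
  have hle : pathSpan A B k * pathSpan A B l ≤ pathSpan A B (k + l) := by
    rw [pathSpan, pathSpan, Submodule.span_mul_span, Submodule.span_le]
    rintro _ ⟨_, ⟨v', w, q, hq, rfl⟩, _, ⟨u, v, p, hp, rfl⟩, rfl⟩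
    rcases eq_or_ne v' v with rfl | h
    · simp only [pathPair_mul]
      exact pathPair_mem _ (by rw [Path.length_comp]; omega)
    · simp only [pathPair_mul_of_ne A B h]
      exact zero_mem _
  exact hle (Submodule.mul_mem_mul hx hy)

theorem one_mem_pathSpan (k : ℕ) : 1 ∈ pathSpan A B k := by
  have h : (1 : Matrix (Σ v, Fin (d v)) (Σ v, Fin (d v)) ℂ ×
      Matrix (Σ v, Fin (d v)) (Σ v, Fin (d v)) ℂ) =
        ∑ v : V, pathPair A B (Path.nil : Path v v) := by
    ext1 <;> simp [pathPair, Prod.fst_sum, Prod.snd_sum, pathMatrixC,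
      sum_vertexIncl_mul_conjTranspose]
  rw [h]
  exact Submodule.sum_mem _ fun v _ => pathPair_mem _ (Nat.zero_le _)

theorem trace_fst_eq_trace_snd {N : ℕ}
    (htr : ∀ (u : V) (p : Path u u), 0 < p.length → p.length ≤ N →
      (pathMatrixC d A p).trace = (pathMatrixC d B p).trace)
    {x : Matrix (Σ v, Fin (d v)) (Σ v, Fin (d v)) ℂ × Matrix (Σ v, Fin (d v)) (Σ v, Fin (d v)) ℂ}
    (hx : x ∈ pathSpan A B N) : x.1.trace = x.2.trace := by
  induction hx using Submodule.span_induction with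
  | mem x hx =>
    obtain ⟨u, v, p, hp, rfl⟩ := hx
    simp only [pathPair]
    rw [trace_mul_comm, trace_mul_comm _ (vertexIncl d u)ᴴ, ← Matrix.mul_assoc, ← Matrix.mul_assoc]
    rcases eq_or_ne u v with rfl | h
    · rw [vertexIncl_conjTranspose_mul_self, Matrix.one_mul, Matrix.one_mul]
      rcases Nat.eq_zero_or_pos p.length with h0 | h0
      · rw [Path.eq_nil_of_length_zero p h0]
        simp [pathMatrixC]
      · exact htr u p h0 hp
    · simp [vertexIncl_conjTranspose_mul_of_ne h]
  | zero => simp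
  | add x y _ _ hx hy => simp [hx, hy]
  | smul c x _ hx => simp [hx]

theorem pathSpan_le_of_succ_le {k : ℕ} (h : pathSpan A B (k + 1) ≤ pathSpan A B k) (m : ℕ) :
    pathSpan A B m ≤ pathSpan A B k := by
  induction m with
  | zero => exact pathSpan_mono (Nat.zero_le _)
  | succ m ih =>
    refine Submodule.span_le.2 ?_
    rintro _ ⟨u, v, p, hp, rfl⟩
    cases p with
    | nil => exact pathPair_mem _ (Nat.zero_le _)
    | @cons w _ p e =>
      have h1 : pathPair A B (p.cons e) = pathPair A B e.toPath * pathPair A B p := by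
        rw [pathPair_mul]
        rfl
      rw [h1, SetLike.mem_coe]
      have h2 := mul_mem_pathSpan (pathPair_mem (A := A) (B := B) (k := 1) e.toPath le_rfl)
        (ih (pathPair_mem p (Nat.le_of_succ_le_succ hp)))
      rw [add_comm] at h2
      exact h h2

/-- Spans of path matrices stabilize within as many steps as the dimension of the matrix algebra,
because matching traces make the first projection injective on them. -/
theorem exists_pathSpan_succ_le [HasReverse V]
    (hA : ∀ (u v : V) (e : u ⟶ v), A v u (reverse e) = (A u v e)ᴴ)
    (hB : ∀ (u v : V) (e : u ⟶ v), B v u (reverse e) = (B u v e)ᴴ) {N D : ℕ}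
    (hD : D = (∑ v, d v) ^ 2) (hN : 2 * (D + 1) ≤ N)
    (htr : ∀ (u : V) (p : Path u u), 0 < p.length → p.length ≤ N →
      (pathMatrixC d A p).trace = (pathMatrixC d B p).trace) :
    ∃ k ≤ D, pathSpan A B (k + 1) ≤ pathSpan A B k := by
  by_contra! hcon
  have hdim : ∀ k ≤ D + 1, k ≤ Module.finrank ℂ (pathSpan A B k) := by
    intro k
    induction k with
    | zero => simp
    | succ k ih =>
      intro hk
      have hlt : pathSpan A B k < pathSpan A B (k + 1) :=
        lt_of_le_not_ge (pathSpan_mono k.le_succ) (hcon k (by omega))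
      have := Submodule.finrank_lt_finrank_of_lt hlt
      have := ih (by omega)
      omega
  let f := (LinearMap.fst ℂ (Matrix (Σ v, Fin (d v)) (Σ v, Fin (d v)) ℂ)
    (Matrix (Σ v, Fin (d v)) (Σ v, Fin (d v)) ℂ)).comp (pathSpan A B (D + 1)).subtype
  have hf : Function.Injective f := by
    refine (injective_iff_map_eq_zero f).2 fun ⟨x, hx⟩ h0 => Subtype.ext ?_
    have h0' : x.1 = 0 := h0
    have h1 := mul_mem_pathSpan (star_mem_pathSpan hA hB hx) hx
    have h2 := trace_fst_eq_trace_snd htr (pathSpan_mono (by omega) h1)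
    simp only [Prod.fst_mul, Prod.snd_mul, h0', mul_zero, trace_zero, Prod.snd_star,
      star_eq_conjTranspose] at h2
    exact Prod.ext h0' (trace_conjTranspose_mul_self_eq_zero_iff.1 h2.symm)
  have h1 := LinearMap.finrank_le_finrank_of_injective hf
  have h2 := hdim (D + 1) le_rfl
  rw [Module.finrank_matrix, Module.finrank_self, Fintype.card_sigma] at h1
  simp only [Fintype.card_fin, mul_one, ← sq, ← hD] at h1
  omega

/-- Specht's criterion for representations, compatible with a reversal of arrows, of a quiver. -/
theorem exists_unitary_of_trace_eq [HasReverse V]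
    (hA : ∀ (u v : V) (e : u ⟶ v), A v u (reverse e) = (A u v e)ᴴ)
    (hB : ∀ (u v : V) (e : u ⟶ v), B v u (reverse e) = (B u v e)ᴴ) {N : ℕ}
    (hN : 2 * ((∑ v, d v) ^ 2 + 1) ≤ N)
    (htr : ∀ (u : V) (p : Path u u), 0 < p.length → p.length ≤ N →
      (pathMatrixC d A p).trace = (pathMatrixC d B p).trace) :
    ∃ U : ∀ v : V, Matrix (Fin (d v)) (Fin (d v)) ℂ,
      (∀ v : V, (U v)ᴴ * U v = 1) ∧
      ∀ (u v : V) (e : u ⟶ v), B u v e = (U v)⁻¹ * A u v e * U u := by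
  obtain ⟨k, hk, hle⟩ := exists_pathSpan_succ_le hA hB rfl hN htr
  obtain ⟨W, h1, h2, h3⟩ := exists_partialIsometry_intertwining (S := pathSpan A B k) (e := 1)
    (fun x hx y hy => pathSpan_le_of_succ_le hle _ (mul_mem_pathSpan hx hy))
    (fun x hx => star_mem_pathSpan hA hB hx)
    (fun x hx => trace_fst_eq_trace_snd htr (pathSpan_mono (by omega) hx))
    (one_mem_pathSpan k) (star_one _) (fun x _ => one_mul x)
  have hpath {u v : V} (p : Path u v) : W * (pathPair A B p).1 = (pathPair A B p).2 * W :=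
    h3 _ (pathSpan_le_of_succ_le hle _ (pathPair_mem p le_rfl))
  have hW (v : V) : W * vertexIncl d v * (vertexIncl d v)ᴴ =
      vertexIncl d v * (vertexIncl d v)ᴴ * W := by
    simpa [pathPair, pathMatrixC, Matrix.mul_assoc] using hpath (Path.nil : Path v v)
  have hWl (v : V) : W * vertexIncl d v =
      vertexIncl d v * ((vertexIncl d v)ᴴ * W * vertexIncl d v) := by
    have := congrArg (· * vertexIncl d v) (hW v)
    simpa only [Matrix.mul_assoc, vertexIncl_conjTranspose_mul_self, Matrix.mul_one] using this
  have hWr (v : V) : (vertexIncl d v)ᴴ * W =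
      (vertexIncl d v)ᴴ * W * vertexIncl d v * (vertexIncl d v)ᴴ := by
    have := congrArg ((vertexIncl d v)ᴴ * ·) (hW v)
    simp only [← Matrix.mul_assoc, vertexIncl_conjTranspose_mul_self, Matrix.one_mul] at this
    exact this.symm
  set X : ∀ v : V, Matrix (Fin (d v)) (Fin (d v)) ℂ :=
    fun v => (vertexIncl d v)ᴴ * W * vertexIncl d v with hX
  have hXX (v : V) : X v * (X v)ᴴ = 1 := by
    have h4 : (X v)ᴴ = (vertexIncl d v)ᴴ * Wᴴ * vertexIncl d v := by
      simp [hX, Matrix.mul_assoc]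
    rw [h4]
    calc X v * ((vertexIncl d v)ᴴ * Wᴴ * vertexIncl d v)
        = (X v * (vertexIncl d v)ᴴ) * Wᴴ * vertexIncl d v := by simp only [Matrix.mul_assoc]
      _ = (vertexIncl d v)ᴴ * (W * Wᴴ) * vertexIncl d v := by
          rw [← hWr]
          simp only [Matrix.mul_assoc]
      _ = 1 := by
          rw [h2]
          simp [vertexIncl_conjTranspose_mul_self]
  refine ⟨fun v => (X v)ᴴ, fun v => by rw [conjTranspose_conjTranspose, hXX], fun u v e => ?_⟩
  have hinv : ((X v)ᴴ)⁻¹ = X v := Matrix.inv_eq_left_inv (hXX v)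
  have h5 : X v * A u v e = B u v e * X u := by
    have h6 := hpath e.toPath
    have h7 : W * (vertexIncl d v * A u v e * (vertexIncl d u)ᴴ) =
        vertexIncl d v * B u v e * (vertexIncl d u)ᴴ * W := by
      simpa [pathPair, pathMatrixC, Hom.toPath] using h6
    have h8 := congrArg (fun M => (vertexIncl d v)ᴴ * M * vertexIncl d u) h7
    simp only [Matrix.mul_assoc, vertexIncl_conjTranspose_mul_self, Matrix.mul_one] at h8
    simpa only [hX, ← Matrix.mul_assoc, vertexIncl_conjTranspose_mul_self, Matrix.one_mul] using h8
  rw [hinv, h5, Matrix.mul_assoc, hXX, Matrix.mul_one]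

end QuiverPaths

/-- **Specht's criterion for matrix representations of a quiver, with Laffey's bound
`φ(n) = n²` on the cycle length** (Futorny–Horn–Sergeichuk, Theorem 2(b)).  Let `m i j`
be the number of arrows from `j` to `i` and let `r` be the minimal natural number with
`r(r+1)/2 ≥ max m i j`.  If two complex matrix representations `A`, `B` of dimension `d`
of a quiver with finitely many vertices and arrows have equal traces along all oriented
cycles of the doubled quiver of length at most `((r+2)(d₁+⋯+d_t))²`, then `A` and `B`
are unitarily isometric. -/
theorem matrixRep_unitarily_isometric_of_bounded_traces {V : Type} [Fintype V] [Quiver V]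
    [∀ u v : V, Fintype (u ⟶ v)] (d : V → ℕ) (r : ℕ)
    (hr : ∀ i j : V, Fintype.card (j ⟶ i) ≤ r * (r + 1) / 2)
    (hrmin : ∀ r' : ℕ, (∀ i j : V, Fintype.card (j ⟶ i) ≤ r' * (r' + 1) / 2) → r ≤ r')
    (A B : ∀ u v : V, (u ⟶ v) → Matrix (Fin (d v)) (Fin (d u)) ℂ)
    (htr : ∀ (u : Symmetrify V) (p : Path u u), 0 < p.length →
      p.length ≤ ((r + 2) * ∑ v : V, d v) ^ 2 →
      (pathMatrixC (V := Symmetrify V) d (doubledRepH d A) p).trace =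
      (pathMatrixC (V := Symmetrify V) d (doubledRepH d B) p).trace) :
    ∃ U : ∀ v : V, Matrix (Fin (d v)) (Fin (d v)) ℂ,
      (∀ v : V, (U v)ᴴ * U v = 1) ∧
      ∀ (u v : V) (e : u ⟶ v), B u v e = (U v)⁻¹ * A u v e * U u := by
  classical
  rcases Nat.eq_zero_or_pos (∑ v, d v) with h0 | h0
  · have hd (v : V) : d v = 0 := (Finset.sum_eq_zero_iff.1 h0) v (Finset.mem_univ v)
    have hempty (v : V) : IsEmpty (Fin (d v)) := by
      rw [hd v]
      infer_instance
    exact ⟨fun _ => 1, fun _ => by simp, fun _ v _ => Subsingleton.elim _ _⟩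
  · let _ : Fintype (Symmetrify V) := ‹Fintype V›
    refine exists_unitary_of_trace_eq (V := Symmetrify V) ?_ ?_ ?_ htr |>.imp
      fun U hU => ⟨hU.1, fun u v e => hU.2 u v (Sum.inl e)⟩
    · rintro u v (e | e)
      · rfl
      · exact (conjTranspose_conjTranspose _).symm
    · rintro u v (e | e)
      · rfl
      · exact (conjTranspose_conjTranspose _).symm
    · have hs : (∑ v : Symmetrify V, d v) = ∑ v : V, d v := rfl
      rw [hs]
      nlinarith [Nat.zero_le (r * (∑ v, d v) ^ 2), Nat.zero_le (r ^ 2 * (∑ v, d v) ^ 2),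
        Nat.mul_le_mul h0 h0]
end
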